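/- arXiv:2408.07235 — 2 statements merged into one kernel-verified Lean document; each statement's English description precedes it below -/
import Mathlib

section
/- Let L ∈ B(H,G) satisfy 0 < ‖L‖ ≤ 1, let g : G → (−∞,+∞] be proper with a continuous affine minorant, and let γ > 0. Then, as set-valued operators: (i) ∂(L ⊙_γ g) = L* ▷ (∂g** + (Id_G − L∘L*)/γ), where for a set-valued A : G ⇒ G the parallel composition is L* ▷ A = (L* ∘ A⁻¹ ∘ L)⁻¹, i.e. the graph of ∂(L ⊙_γ g) is {(x, x*) : ∃ y ∈ G, L*y has x* ∈ (stated relation)}; explicitly, ∂(L ⊙_γ g) = ( L* ∘ (∂g** + (Id_G − L∘L*)/γ)⁻¹ ∘ L )⁻¹; (ii) ∂(L ⊚_γ g) = L* ∘ (∂g* + γ(Id_G − L∘L*))⁻¹ ∘ L. -/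
open scoped RealInnerProductSpace
open Filter Set

noncomputable section

/-- Fenchel (Legendre) conjugate of an extended-real-valued function. -/
def fconj {H : Type*} [NormedAddCommGroup H] [InnerProductSpace ℝ H]
    (f : H → EReal) : H → EReal :=
  fun xs => ⨆ x : H, (⟪x, xs⟫ : EReal) - f x

/-- Moreau envelope of index `γ`. -/
def menv {H : Type*} [NormedAddCommGroup H] (γ : ℝ) (f : H → EReal) : H → EReal :=
  fun x => ⨅ y : H, f y + ((‖x - y‖ ^ 2 / (2 * γ) : ℝ) : EReal)

/-- Quadratic kernel `Q`. -/
def qk {H : Type*} [NormedAddCommGroup H] (x : H) : ℝ := ‖x‖ ^ 2 / 2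

/-- Proximal composition `L ⊙_γ g`. -/
def proxComp {H G : Type*} [NormedAddCommGroup H] [InnerProductSpace ℝ H]
    [NormedAddCommGroup G] [InnerProductSpace ℝ G]
    (L : H →L[ℝ] G) (γ : ℝ) (g : G → EReal) : H → EReal :=
  fun x => fconj (fun z => menv (1 / γ) (fconj g) (L z)) x - (((1 / γ) * qk x : ℝ) : EReal)

/-- Proximal cocomposition `L ⊚_γ g`. -/
def proxCocomp {H G : Type*} [NormedAddCommGroup H] [InnerProductSpace ℝ H]
    [NormedAddCommGroup G] [InnerProductSpace ℝ G]
    (L : H →L[ℝ] G) (γ : ℝ) (g : G → EReal) : H → EReal :=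
  fconj (proxComp L (1 / γ) (fconj g))

/-- `f` is proper: not identically `+∞` and never `−∞`. -/
def ProperE {H : Type*} (f : H → EReal) : Prop :=
  (∃ x, f x ≠ ⊤) ∧ ∀ x, f x ≠ ⊥

/-- `f` admits a continuous affine minorant. -/
def HasAffMinorant {H : Type*} [NormedAddCommGroup H] [InnerProductSpace ℝ H]
    (f : H → EReal) : Prop :=
  ∃ (u : H) (c : ℝ), ∀ x, ((⟪x, u⟫ + c : ℝ) : EReal) ≤ f x

/-- Convexity for extended-real-valued functions. -/
def ConvexE {H : Type*} [NormedAddCommGroup H] [InnerProductSpace ℝ H]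
    (f : H → EReal) : Prop :=
  ∀ x y : H, ∀ a b : ℝ, 0 < a → 0 < b → a + b = 1 →
    f (a • x + b • y) ≤ ((a : ℝ) : EReal) * f x + ((b : ℝ) : EReal) * f y

/-- The class `Γ₀`: proper, lower semicontinuous, convex. -/
def IsGamma0 {H : Type*} [NormedAddCommGroup H] [InnerProductSpace ℝ H]
    (f : H → EReal) : Prop :=
  ProperE f ∧ LowerSemicontinuous f ∧ ConvexE f

/-- `p` is a proximal point of `f` at `x`. -/
def IsProx {H : Type*} [NormedAddCommGroup H] (f : H → EReal) (x p : H) : Prop :=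
  ∀ y : H, f p + ((‖x - p‖ ^ 2 / 2 : ℝ) : EReal) ≤ f y + ((‖x - y‖ ^ 2 / 2 : ℝ) : EReal)

/-- Subdifferential. -/
def SubdiffE {H : Type*} [NormedAddCommGroup H] [InnerProductSpace ℝ H]
    (f : H → EReal) (x : H) : Set H :=
  {xs | ∀ y : H, (⟪y - x, xs⟫ : EReal) + f x ≤ f y}

/-- Recession function. -/
def recE {H : Type*} [NormedAddCommGroup H] (f : H → EReal) : H → EReal :=
  fun x => ⨆ y : {y : H // f y ≠ ⊤}, f (x + (y : H)) - f (y : H)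

end

section Conjugate

variable {E : Type*} [NormedAddCommGroup E] [InnerProductSpace ℝ E]

lemma EReal.le_of_forall_le_coe {a b : EReal} (h : ∀ r : ℝ, b ≤ r → a ≤ r) : a ≤ b := by
  induction b with
  | bot =>
    refine le_of_eq (EReal.eq_bot_iff_forall_lt a |>.2 fun y => ?_)
    exact (h (y - 1) bot_le).trans_lt (by exact_mod_cast sub_one_lt y)
  | coe b => exact h b le_rfl
  | top => exact le_top

lemma fconj_le_coe_iff {f : E → EReal} {v : E} {s : ℝ} :
    fconj f v ≤ s ↔ ∀ (x : E) (r : ℝ), f x ≤ r → ⟪x, v⟫ - r ≤ s := by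
  unfold fconj
  rw [iSup_le_iff]
  refine forall_congr' fun x => ?_
  induction f x with
  | bot =>
    simp only [EReal.coe_sub_bot, top_le_iff, EReal.coe_ne_top, bot_le, true_imp_iff, false_iff,
      not_forall, not_le]
    exact ⟨⟪x, v⟫ - s - 1, by linarith⟩
  | coe b =>
    constructor
    · intro h r hr
      have h' : ⟪x, v⟫ - b ≤ s := by exact_mod_cast h
      have hr' : b ≤ r := by exact_mod_cast hr
      linarith
    · intro h
      exact_mod_cast h b le_rfl
  | top => simp

lemma coe_le_fconj {f : E → EReal} {x : E} {r : ℝ} (h : f x ≤ r) (v : E) :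
    ((⟪x, v⟫ - r : ℝ) : EReal) ≤ fconj f v :=
  EReal.le_of_forall_le_coe fun _ hs => EReal.coe_le_coe_iff.2 (fconj_le_coe_iff.1 hs x r h)

lemma fconj_fconj_le (f : E → EReal) (x : E) : fconj (fconj f) x ≤ f x :=
  EReal.le_of_forall_le_coe fun r hr => fconj_le_coe_iff.2 fun v s hs => by
    have := fconj_le_coe_iff.1 hs x r hr
    rw [real_inner_comm]
    linarith

lemma fconj_antitone {f h : E → EReal} (hfh : ∀ x, f x ≤ h x) (v : E) :
    fconj h v ≤ fconj f v :=
  iSup_mono fun x => EReal.sub_le_sub le_rfl (hfh x)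

lemma fconj_fconj_fconj (f : E → EReal) : fconj (fconj (fconj f)) = fconj f :=
  funext fun v => le_antisymm (fconj_fconj_le _ v) (fconj_antitone (fconj_fconj_le f) v)

lemma mem_subdiffE_iff {f : E → EReal} {x u : E} {s : ℝ} (hx : f x = s) :
    u ∈ SubdiffE f x ↔ ∀ (y : E) (r : ℝ), f y ≤ r → ⟪y - x, u⟫ + s ≤ r := by
  simp only [SubdiffE, Set.mem_ofPred_eq, hx]
  refine forall_congr' fun y => ⟨fun h r hr => ?_, fun h => ?_⟩
  · exact_mod_cast h.trans hr
  · exact EReal.le_of_forall_le_coe fun r hr => by exact_mod_cast h r hr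

lemma exists_coe_eq_of_mem_subdiffE {f : E → EReal} {x u z : E} {r : ℝ}
    (hu : u ∈ SubdiffE f x) (hz : f z ≤ r) (hbot : f x ≠ ⊥) : ∃ s : ℝ, f x = s := by
  have h := (hu z).trans hz
  induction hfx : f x with
  | bot => exact absurd hfx hbot
  | coe s => exact ⟨s, rfl⟩
  | top => simp [hfx] at h

lemma fconj_ne_bot {f : E → EReal} {x : E} {r : ℝ} (h : f x ≤ r) (v : E) : fconj f v ≠ ⊥ :=
  fun hb => EReal.coe_ne_bot _ (le_bot_iff.1 (hb ▸ coe_le_fconj h v))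

lemma fconj_eq_of_mem_subdiffE {f : E → EReal} {x u : E} {s : ℝ} (hx : f x = s)
    (hu : u ∈ SubdiffE f x) : fconj f u = ((⟪x, u⟫ - s : ℝ) : EReal) := by
  refine le_antisymm (fconj_le_coe_iff.2 fun y r hr => ?_) (coe_le_fconj hx.le u)
  have := (mem_subdiffE_iff hx).1 hu y r hr
  rw [inner_sub_left] at this
  linarith

lemma mem_subdiffE_fconj {f : E → EReal} {x u : E} {s : ℝ} (hx : f x = s)
    (hu : u ∈ SubdiffE f x) : x ∈ SubdiffE (fconj f) u := by
  refine (mem_subdiffE_iff (fconj_eq_of_mem_subdiffE hx hu)).2 fun v r hr => ?_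
  have := fconj_le_coe_iff.1 hr x s hx.le
  rw [inner_sub_left, real_inner_comm x v, real_inner_comm x u]
  linarith

/-- If `∂f` contains `(x, u)` and `(x', u')` with `u + t x = u' + t x'` for some `t > 0`,
then `x = x'`. -/
lemma eq_of_mem_subdiffE_of_sub_eq_smul {f : E → EReal} {x x' u u' : E} {s t : ℝ}
    (hx' : f x' = s) (hu' : u' ∈ SubdiffE f x') (hu : u ∈ SubdiffE f x) (ht : 0 < t)
    (h : u - u' = t • (x' - x)) : x = x' := by
  have hbot : f x ≠ ⊥ := fun hb => by
    have := hu' x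
    rw [hx', hb, ← EReal.coe_add] at this
    simp at this
  obtain ⟨a, ha⟩ := exists_coe_eq_of_mem_subdiffE hu hx'.le hbot
  have h1 := (mem_subdiffE_iff hx').1 hu' x a ha.le
  have h2 := (mem_subdiffE_iff ha).1 hu x' s hx'.le
  have h3 : ⟪x' - x, u - u'⟫ ≤ 0 := by
    rw [← neg_sub x' x, inner_neg_left] at h1
    rw [inner_sub_right]
    linarith
  rw [h, inner_smul_right, real_inner_self_eq_norm_sq] at h3
  have h4 : ‖x' - x‖ ^ 2 ≤ 0 := by
    by_contra! hc
    linarith [mul_pos ht hc]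
  have h5 : ‖x' - x‖ = 0 := by nlinarith [norm_nonneg (x' - x)]
  exact (sub_eq_zero.1 (norm_eq_zero.1 h5)).symm

lemma fconj_le_coe_combo {f : E → EReal} {v v' : E} {s s' a b : ℝ} (h : fconj f v ≤ s)
    (h' : fconj f v' ≤ s') (ha : 0 ≤ a) (hb : 0 ≤ b) (hab : a + b = 1) :
    fconj f (a • v + b • v') ≤ ((a * s + b * s' : ℝ) : EReal) :=
  fconj_le_coe_iff.2 fun x r hr => by
    have h1 := mul_le_mul_of_nonneg_left (fconj_le_coe_iff.1 h x r hr) ha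
    have h2 := mul_le_mul_of_nonneg_left (fconj_le_coe_iff.1 h' x r hr) hb
    rw [inner_add_right, inner_smul_right, inner_smul_right]
    have h3 : r = a * r + b * r := by rw [← add_mul, hab, one_mul]
    linarith

lemma fconj_le_coe_of_tendsto {f : E → EReal} {v : ℕ → E} {s : ℕ → ℝ} {p : E} {c : ℝ}
    (h : ∀ n, fconj f (v n) ≤ s n) (hv : Tendsto v atTop (nhds p))
    (hs : Tendsto s atTop (nhds c)) : fconj f p ≤ c :=
  fconj_le_coe_iff.2 fun x r hr =>
    le_of_tendsto_of_tendsto' ((tendsto_const_nhds.inner hv).sub_const r) hs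
      fun n => fconj_le_coe_iff.1 (h n) x r hr

/-- Existence of a minimizer of `f* + t‖w - ·‖²/2`. -/
lemma exists_fconj_prox [CompleteSpace E] {f : E → EReal} {x₀ v₀ : E} {r₀ s₀ t : ℝ}
    (hx₀ : f x₀ ≤ r₀) (hv₀ : fconj f v₀ ≤ s₀) (ht : 0 < t) (w : E) :
    ∃ (p : E) (s : ℝ), fconj f p ≤ s ∧ ∀ (v : E) (r : ℝ), fconj f v ≤ r →
      s + t / 2 * ‖w - p‖ ^ 2 ≤ r + t / 2 * ‖w - v‖ ^ 2 := by
  set S : Set ℝ := {j | ∃ (v : E) (r : ℝ), fconj f v ≤ r ∧ j = r + t / 2 * ‖w - v‖ ^ 2}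
  have hne : S.Nonempty := ⟨_, v₀, s₀, hv₀, rfl⟩
  have hbdd : BddBelow S := by
    refine ⟨⟪x₀, w⟫ - r₀ - ‖x₀‖ ^ 2 / (2 * t), ?_⟩
    rintro _ ⟨v, r, hvr, rfl⟩
    have h1 := fconj_le_coe_iff.1 hvr x₀ r₀ hx₀
    have h2 : 0 ≤ ‖x₀ - t • (w - v)‖ ^ 2 / (2 * t) := by positivity
    rw [norm_sub_sq_real, inner_smul_right, inner_sub_right, norm_smul, Real.norm_of_nonneg ht.le]
      at h2
    have h3 : (‖x₀‖ ^ 2 - 2 * (t * (⟪x₀, w⟫ - ⟪x₀, v⟫)) + (t * ‖w - v‖) ^ 2) / (2 * t)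
        = ‖x₀‖ ^ 2 / (2 * t) - (⟪x₀, w⟫ - ⟪x₀, v⟫) + t / 2 * ‖w - v‖ ^ 2 := by
      field_simp
    linarith
  set m := sInf S
  have hmin : ∀ (v : E) (r : ℝ), fconj f v ≤ r → m ≤ r + t / 2 * ‖w - v‖ ^ 2 :=
    fun v r h => csInf_le hbdd ⟨v, r, h, rfl⟩
  have hseq : ∀ n : ℕ, ∃ (v : E) (r : ℝ), fconj f v ≤ r ∧
      r + t / 2 * ‖w - v‖ ^ 2 < m + 1 / ((n : ℝ) + 1) := fun n => by
    obtain ⟨_, ⟨v, r, h, rfl⟩, hlt⟩ := exists_lt_of_csInf_lt hne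
      (show m < m + 1 / ((n : ℝ) + 1) by linarith [Nat.one_div_pos_of_nat (α := ℝ) (n := n)])
    exact ⟨v, r, h, hlt⟩
  choose v r hvr hlt using hseq
  have hdist : ∀ n k, t / 8 * ‖v n - v k‖ ^ 2 ≤
      (1 / ((n : ℝ) + 1) + 1 / ((k : ℝ) + 1)) / 2 := fun n k => by
    have h1 := hmin _ _ (fconj_le_coe_combo (hvr n) (hvr k) (a := 1 / 2) (b := 1 / 2)
      (by norm_num) (by norm_num) (by norm_num))
    have h2 := parallelogram_law_with_norm ℝ (w - v n) (w - v k)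
    have h3 : w - v n + (w - v k) = (2 : ℝ) • (w - ((1 / 2 : ℝ) • v n + (1 / 2 : ℝ) • v k)) := by
      module
    have h4 : w - v n - (w - v k) = -(v n - v k) := by abel
    rw [h3, h4, norm_neg, norm_smul, Real.norm_ofNat] at h2
    have h5 := congrArg (t / 8 * ·) h2
    have h6 := hlt n
    have h7 := hlt k
    linarith
  have hcauchy : CauchySeq v := by
    refine Metric.cauchySeq_iff'.2 fun ε hε => ?_
    obtain ⟨N, hN⟩ := exists_nat_one_div_lt (show 0 < t / 8 * ε ^ 2 by positivity)
    refine ⟨N, fun n hn => ?_⟩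
    have h1 : 1 / ((n : ℝ) + 1) ≤ 1 / ((N : ℝ) + 1) := Nat.one_div_le_one_div hn
    have h2 := hdist n N
    rw [dist_eq_norm]
    refine lt_of_pow_lt_pow_left₀ 2 hε.le (lt_of_mul_lt_mul_left ?_ (show 0 ≤ t / 8 by positivity))
    linarith
  obtain ⟨p, hp⟩ := cauchySeq_tendsto_of_complete hcauchy
  refine ⟨p, m - t / 2 * ‖w - p‖ ^ 2, ?_, fun v' r' h => by linarith [hmin v' r' h]⟩
  refine fconj_le_coe_of_tendsto
    (s := fun n : ℕ => m + 1 / ((n : ℝ) + 1) - t / 2 * ‖w - v n‖ ^ 2) (fun n => ?_) hp ?_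
  · exact (hvr n).trans (EReal.coe_le_coe_iff.2 (by linarith [hlt n]))
  · have h1 : Tendsto (fun n : ℕ => m + 1 / ((n : ℝ) + 1)) atTop (nhds m) := by
      simpa using tendsto_one_div_add_atTop_nhds_zero_nat.const_add m
    exact h1.sub (((tendsto_const_nhds.sub hp).norm.pow 2).const_mul _)

/-- Every `w` decomposes as `p + t⁻¹ u` with `u ∈ ∂f*(p)`. -/
lemma exists_smul_sub_mem_subdiffE_fconj [CompleteSpace E] {f : E → EReal} {x₀ v₀ : E}
    {r₀ s₀ t : ℝ} (hx₀ : f x₀ ≤ r₀) (hv₀ : fconj f v₀ ≤ s₀) (ht : 0 < t) (w : E) :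
    ∃ (p : E) (s : ℝ), fconj f p = s ∧ t • (w - p) ∈ SubdiffE (fconj f) p := by
  obtain ⟨p, s, hps, hmin⟩ := exists_fconj_prox hx₀ hv₀ ht w
  have heq : fconj f p = s := le_antisymm hps <| EReal.le_of_forall_le_coe fun r hr =>
    EReal.coe_le_coe_iff.2 (by linarith [hmin p r hr])
  refine ⟨p, s, heq, (mem_subdiffE_iff heq).2 fun v r hr => ?_⟩
  rw [inner_smul_right]
  have key : ∀ a : ℝ, 0 < a → a ≤ 1 →
      t * ⟪v - p, w - p⟫ + s - r ≤ a * (t / 2 * ‖v - p‖ ^ 2) := fun a ha ha1 => by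
    have h1 := hmin _ _ (fconj_le_coe_combo hps hr (sub_nonneg.2 ha1) ha.le (sub_add_cancel 1 a))
    have h2 : w - ((1 - a) • p + a • v) = (w - p) - a • (v - p) := by module
    rw [h2, norm_sub_sq_real (w - p), inner_smul_right, norm_smul, Real.norm_of_nonneg ha.le,
      real_inner_comm] at h1
    refine le_of_mul_le_mul_left ?_ ha
    linarith
  have hlim : Tendsto (fun a : ℝ => a * (t / 2 * ‖v - p‖ ^ 2)) (nhdsWithin 0 (Set.Ioi 0))
      (nhds 0) := by
    have : Tendsto (fun a : ℝ => a * (t / 2 * ‖v - p‖ ^ 2)) (nhds 0) (nhds 0) := by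
      simpa using (tendsto_id (α := ℝ) (x := nhds 0)).mul_const (t / 2 * ‖v - p‖ ^ 2)
    exact this.mono_left nhdsWithin_le_nhds
  have := ge_of_tendsto hlim (b := t * ⟪v - p, w - p⟫ + s - r) (by
    filter_upwards [Ioc_mem_nhdsGT (show (0 : ℝ) < 1 by norm_num)] with a ha
    exact key a ha.1 ha.2)
  linarith

end Conjugate

section ProxComp

variable {H G : Type*} [NormedAddCommGroup H] [InnerProductSpace ℝ H]
  [NormedAddCommGroup G] [InnerProductSpace ℝ G]

lemma coe_le_menv {f : G → EReal} {γ s : ℝ} {p y : G} (hγ : 0 < γ) (hp : f p = s)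
    (hy : y ∈ SubdiffE f p) (w : G) :
    ((s + ‖y‖ ^ 2 / (2 * γ) + ⟪w - (p + (1 / γ) • y), y⟫ : ℝ) : EReal) ≤ menv (1 / γ) f w := by
  refine le_iInf fun v => EReal.le_of_forall_le_coe fun r hr => EReal.coe_le_coe_iff.2 ?_
  have hfv : f v ≤ ((r - ‖w - v‖ ^ 2 / (2 * (1 / γ)) : ℝ) : EReal) := by
    rw [EReal.coe_sub]
    exact EReal.le_sub_iff_add_le (by simp) (by simp) |>.2 hr
  have h1 := (mem_subdiffE_iff hp).1 hy v _ hfv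
  have h2 : 0 ≤ ‖γ • (w - v) - y‖ ^ 2 / (2 * γ) := by positivity
  rw [norm_sub_sq_real, inner_smul_left, norm_smul, Real.norm_of_nonneg hγ.le] at h2
  simp only [inner_sub_left, inner_add_left, inner_smul_left, real_inner_self_eq_norm_sq,
    RCLike.conj_to_real] at h1 h2 ⊢
  have h3 : ((γ * ‖w - v‖) ^ 2 - 2 * (γ * (⟪w, y⟫ - ⟪v, y⟫)) + ‖y‖ ^ 2) / (2 * γ)
      = ‖w - v‖ ^ 2 / (2 * (1 / γ)) - (⟪w, y⟫ - ⟪v, y⟫) + ‖y‖ ^ 2 / (2 * γ) := by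
    field_simp
  have h4 : 1 / γ * ‖y‖ ^ 2 = 2 * (‖y‖ ^ 2 / (2 * γ)) := by field_simp
  linarith

lemma mem_subdiffE_proxComp [CompleteSpace H] [CompleteSpace G] {L : H →L[ℝ] G}
    (hL : ‖L‖ ≤ 1) {g : G → EReal} {γ s : ℝ} (hγ : 0 < γ) {p y : G} (hp : fconj g p = s) (hy : y ∈ SubdiffE (fconj g) p) {xs : H}
    (hxs : L xs = p + (1 / γ) • (y - L (ContinuousLinearMap.adjoint L y))) :
    (∃ b : ℝ, proxComp L γ g (ContinuousLinearMap.adjoint L y) = b) ∧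
      xs ∈ SubdiffE (proxComp L γ g) (ContinuousLinearMap.adjoint L y) := by
  set x := ContinuousLinearMap.adjoint L y with hx
  set F : H → EReal := fun z => menv (1 / γ) (fconj g) (L z) with hF
  set w := xs + (1 / γ) • x with hw
  have hLw : L w = p + (1 / γ) • y := by
    rw [hw, map_add, map_smul, hxs]
    module
  set K := s + ‖y‖ ^ 2 / (2 * γ) with hK
  have hlow : ∀ z : H, ((K + ⟪z - w, x⟫ : ℝ) : EReal) ≤ F z := fun z => by
    have := coe_le_menv hγ hp hy (L z)
    rwa [← hLw, ← map_sub, ← ContinuousLinearMap.adjoint_inner_right] at this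
  have hup : ∀ z : H, F (w + z) ≤ ((K + ⟪z, x⟫ + γ / 2 * ‖z‖ ^ 2 : ℝ) : EReal) := fun z => by
    refine (iInf_le _ p).trans ?_
    rw [hp, ← EReal.coe_add, EReal.coe_le_coe_iff]
    have h1 : L (w + z) - p = (1 / γ) • y + L z := by rw [map_add, hLw]; abel
    have h2 : ‖L z‖ ^ 2 ≤ ‖z‖ ^ 2 := by
      have : ‖L z‖ ≤ ‖z‖ := by simpa using L.le_of_opNorm_le hL z
      gcongr
    have h3 : ⟪y, L z⟫ = ⟪z, x⟫ := by
      rw [hx, ContinuousLinearMap.adjoint_inner_right, real_inner_comm]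
    rw [h1, norm_add_sq_real, inner_smul_left, norm_smul, Real.norm_of_nonneg (by positivity), h3]
    have h4 : ((1 / γ * ‖y‖) ^ 2 + 2 * ((1 / γ) * ⟪z, x⟫) + ‖L z‖ ^ 2) / (2 * (1 / γ))
        = ‖y‖ ^ 2 / (2 * γ) + ⟪z, x⟫ + γ / 2 * ‖L z‖ ^ 2 := by field_simp
    simp only [RCLike.conj_to_real]
    rw [h4, hK]
    linarith [mul_le_mul_of_nonneg_left h2 (show 0 ≤ γ / 2 by positivity)]
  have hconj : ∀ z : H,
      ((⟪z, w⟫ - K + 1 / (2 * γ) * ‖z - x‖ ^ 2 : ℝ) : EReal) ≤ fconj F z := fun z => by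
    refine le_trans (EReal.coe_le_coe_iff.2 (le_of_eq ?_)) (coe_le_fconj (hup ((1 / γ) • (z - x))) z)
    have h1 : ‖z - x‖ ^ 2 = ⟪z - x, z⟫ - ⟪z - x, x⟫ := by
      rw [← inner_sub_right, real_inner_self_eq_norm_sq]
    rw [inner_add_left, inner_smul_left, inner_smul_left, norm_smul,
      Real.norm_of_nonneg (by positivity), mul_pow, real_inner_comm w z]
    simp only [RCLike.conj_to_real]
    have h2 : γ / 2 * ((1 / γ) ^ 2 * ‖z - x‖ ^ 2) = 1 / γ * ‖z - x‖ ^ 2 / 2 := by field_simp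
    have h3 : 1 / (2 * γ) * ‖z - x‖ ^ 2 = 1 / γ * ‖z - x‖ ^ 2 / 2 := by field_simp
    have h4 : 1 / γ * ‖z - x‖ ^ 2 = 1 / γ * ⟪z - x, z⟫ - 1 / γ * ⟪z - x, x⟫ := by
      rw [h1, mul_sub]
    linarith
  have hconjx : fconj F x = ((⟪x, w⟫ - K : ℝ) : EReal) := by
    refine le_antisymm (fconj_le_coe_iff.2 fun z r hr => ?_) (by simpa using hconj x)
    have h1 : K + ⟪z - w, x⟫ ≤ r := by exact_mod_cast (hlow z).trans hr
    rw [inner_sub_left] at h1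
    rw [real_inner_comm w x]
    linarith
  have hval : proxComp L γ g x = ((⟪x, w⟫ - K - 1 / γ * qk x : ℝ) : EReal) := by
    unfold proxComp
    rw [← hF, hconjx, ← EReal.coe_sub]
  refine ⟨⟨_, hval⟩, (mem_subdiffE_iff hval).2 fun z r hr => ?_⟩
  have h1 : fconj F z ≤ ((r + 1 / γ * qk z : ℝ) : EReal) := by
    rw [EReal.coe_add]
    exact (EReal.sub_le_iff_le_add (by simp) (by simp)).1 hr
  have h2 : ⟪z, w⟫ - K + 1 / (2 * γ) * ‖z - x‖ ^ 2 ≤ r + 1 / γ * qk z := by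
    exact_mod_cast (hconj z).trans h1
  rw [norm_sub_sq_real] at h2
  simp only [hw, qk, inner_add_right, inner_smul_right, inner_sub_left,
    real_inner_self_eq_norm_sq] at h2 ⊢
  have h3 : 1 / (2 * γ) * (‖z‖ ^ 2 - 2 * ⟪z, x⟫ + ‖x‖ ^ 2)
      = 1 / γ * (‖z‖ ^ 2 / 2) - 1 / γ * ⟪z, x⟫ + 1 / γ * (‖x‖ ^ 2 / 2) := by field_simp
  linarith

end ProxComp

/-- Subdifferential formulas:
`∂(L ⊙_γ g) = (L* ∘ (∂g** + (Id − L∘L*)/γ)⁻¹ ∘ L)⁻¹` and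
`∂(L ⊚_γ g) = L* ∘ (∂g* + γ(Id − L∘L*))⁻¹ ∘ L`, expressed via graphs of
the set-valued operators. -/
theorem subdiff_of_proxComp_and_proxCocomp
    {H G : Type*} [NormedAddCommGroup H] [InnerProductSpace ℝ H] [CompleteSpace H]
    [NormedAddCommGroup G] [InnerProductSpace ℝ G] [CompleteSpace G]
    (L : H →L[ℝ] G) (hL0 : 0 < ‖L‖) (hL1 : ‖L‖ ≤ 1)
    (g : G → EReal) (hg : ProperE g) (hm : HasAffMinorant g)
    (γ : ℝ) (hγ : 0 < γ) :
    (∀ (x xs : H), xs ∈ SubdiffE (proxComp L γ g) x ↔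
        ∃ y : G, x = ContinuousLinearMap.adjoint L y ∧
          ∃ u ∈ SubdiffE (fconj (fconj g)) y,
            L xs = u + (1 / γ) • (y - L (ContinuousLinearMap.adjoint L y))) ∧
    (∀ (x xs : H), xs ∈ SubdiffE (proxCocomp L γ g) x ↔
        ∃ y : G, xs = ContinuousLinearMap.adjoint L y ∧
          ∃ u ∈ SubdiffE (fconj g) y,
            L x = u + γ • (y - L (ContinuousLinearMap.adjoint L y))) := by
  have hγ' : 0 < 1 / γ := by positivity
  obtain ⟨⟨x₀, hx₀⟩, -⟩ := hg
  obtain ⟨r₀, hr₀⟩ : ∃ r : ℝ, g x₀ ≤ r := ⟨(g x₀).toReal, EReal.le_coe_toReal hx₀⟩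
  obtain ⟨v₀, c, hc⟩ := hm
  have hv₀ : fconj g v₀ ≤ ((-c : ℝ) : EReal) := fconj_le_coe_iff.2 fun x r hr => by
    have : ⟪x, v₀⟫ + c ≤ r := by exact_mod_cast (hc x).trans hr
    linarith
  have hx₀' : fconj (fconj g) x₀ ≤ r₀ := (fconj_fconj_le g x₀).trans hr₀
  refine ⟨fun x xs => ⟨fun h => ?_, ?_⟩, fun x xs => ⟨fun h => ?_, ?_⟩⟩
  · obtain ⟨p, s, hp, hy⟩ :=
      exists_smul_sub_mem_subdiffE_fconj hr₀ hv₀ hγ (L (xs + (1 / γ) • x))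
    set y := γ • (L (xs + (1 / γ) • x) - p) with hydef
    set x' := ContinuousLinearMap.adjoint L y with hx'
    have hLw : L (xs + (1 / γ) • x) = p + (1 / γ) • y := by
      rw [hydef, smul_smul, one_div_mul_cancel hγ.ne', one_smul]
      abel
    have hxs' : L (xs + (1 / γ) • x - (1 / γ) • x') = p + (1 / γ) • (y - L x') := by
      rw [map_sub, hLw, map_smul]
      module
    obtain ⟨⟨b, hb⟩, hmem⟩ := mem_subdiffE_proxComp hL1 hγ hp hy hxs'
    have hxx' : x = x' :=
      eq_of_mem_subdiffE_of_sub_eq_smul hb hmem h hγ' (by module)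
    refine ⟨y, hxx', p, mem_subdiffE_fconj hp hy, ?_⟩
    rw [← hxs', ← hxx', add_sub_cancel_right]
  · rintro ⟨y, rfl, u, hu, hxs⟩
    obtain ⟨s, hs⟩ := exists_coe_eq_of_mem_subdiffE hu hx₀' (fconj_ne_bot hv₀ y)
    have h1 := fconj_eq_of_mem_subdiffE hs hu
    have h2 := mem_subdiffE_fconj hs hu
    rw [fconj_fconj_fconj] at h1 h2
    exact (mem_subdiffE_proxComp hL1 hγ h1 h2 hxs).2
  · obtain ⟨y, s, hy, hu⟩ :=
      exists_smul_sub_mem_subdiffE_fconj hr₀ hv₀ hγ ((1 / γ) • L (x + γ • xs))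
    set u := γ • ((1 / γ) • L (x + γ • xs) - y) with hudef
    set p := ContinuousLinearMap.adjoint L y with hpdef
    have hLr : L (x + γ • xs) = u + γ • y := by
      rw [hudef, smul_sub, smul_smul, mul_one_div_cancel hγ.ne', one_smul]
      abel
    have hx' : L (x + γ • xs - γ • p) = u + γ • (y - L p) := by
      rw [map_sub, hLr, map_smul]
      module
    obtain ⟨⟨b, hb⟩, hmem⟩ := mem_subdiffE_proxComp hL1 hγ'
      (fconj_eq_of_mem_subdiffE hy hu) (mem_subdiffE_fconj hy hu)
      (show L (x + γ • xs - γ • p) = u + (1 / (1 / γ)) • (y - L p) by rwa [one_div_one_div])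
    have hxx' : x = x + γ • xs - γ • p := by
      refine eq_of_mem_subdiffE_of_sub_eq_smul (fconj_eq_of_mem_subdiffE hb hmem)
        (mem_subdiffE_fconj hb hmem) h hγ' ?_
      rw [add_sub_assoc, add_sub_cancel_left, ← smul_sub, smul_smul,
        one_div_mul_cancel hγ.ne', one_smul]
    refine ⟨y, ?_, u, hu, ?_⟩
    · have h1 : γ • (xs - p) = 0 := by
        rw [smul_sub]
        rw [add_sub_assoc] at hxx'
        exact left_eq_add.1 hxx'
      exact sub_eq_zero.1 ((smul_eq_zero.1 h1).resolve_left hγ.ne')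
    · rw [← hx', ← hxx']
  · rintro ⟨y, rfl, u, hu, hx⟩
    obtain ⟨s, hs⟩ := exists_coe_eq_of_mem_subdiffE hu hv₀ (fconj_ne_bot hr₀ y)
    obtain ⟨⟨b, hb⟩, hmem⟩ := mem_subdiffE_proxComp hL1 hγ'
      (fconj_eq_of_mem_subdiffE hs hu) (mem_subdiffE_fconj hs hu)
      (show L x = u + (1 / (1 / γ)) • (y - L (ContinuousLinearMap.adjoint L y)) by
        rwa [one_div_one_div])
    exact mem_subdiffE_fconj hb hmem
end

section
/- Let L ∈ B(H,G) satisfy 0 < ‖L‖ ≤ 1, let β > 0, let γ > 0, and let g : G → ℝ be convex and β-Lipschitzian. Then L ⊚_γ g is a real-valued convex function that is (β‖L‖)-Lipschitzian. -/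
open scoped RealInnerProductSpace
open Filter Set

section Conjugate

theorem menv_le {H : Type*} [NormedAddCommGroup H] {γ : ℝ} (f : H → EReal) (x : H) :
    menv γ f x ≤ f x :=
  (iInf_le _ x).trans (by simp)

variable {H : Type*} [NormedAddCommGroup H] [InnerProductSpace ℝ H]

theorem inner_sub_coe_le_fconj {f : H → EReal} {x : H} {c : ℝ} (h : f x ≤ (c : EReal)) (u : H) :
    ((⟪x, u⟫ - c : ℝ) : EReal) ≤ fconj f u := by
  refine le_trans ?_ (le_iSup (fun x : H => (⟪x, u⟫ : EReal) - f x) x)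
  rw [EReal.coe_sub]
  exact EReal.sub_le_sub le_rfl h

theorem fconj_le_neg_of_affine_le {f : H → EReal} {v : H} {d : ℝ}
    (h : ∀ z, ((⟪z, v⟫ + d : ℝ) : EReal) ≤ f z) : fconj f v ≤ ((-d : ℝ) : EReal) := by
  refine iSup_le fun z => (EReal.sub_le_sub le_rfl (h z)).trans ?_
  rw [← EReal.coe_sub, EReal.coe_le_coe_iff]
  linarith

theorem fconj_eq_top_of_lt_norm {f : H → EReal} {c K : ℝ} (hK : 0 ≤ K)
    (h : ∀ z, f z ≤ ((c + K * ‖z‖ : ℝ) : EReal)) {x : H} (hx : K < ‖x‖) : fconj f x = ⊤ := by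
  rw [EReal.eq_top_iff_forall_lt]
  intro y
  have hx0 : 0 < ‖x‖ := hK.trans_lt hx
  have hp : 0 < ‖x‖ * (‖x‖ - K) := mul_pos hx0 (sub_pos.2 hx)
  set t := (|y + c| + 1) / (‖x‖ * (‖x‖ - K))
  have ht0 : 0 ≤ t := by positivity
  have htp : t * (‖x‖ * (‖x‖ - K)) = |y + c| + 1 :=
    div_mul_cancel₀ _ hp.ne'
  refine lt_of_lt_of_le ?_ (inner_sub_coe_le_fconj (h (t • x)) x)
  rw [EReal.coe_lt_coe_iff, real_inner_smul_left, real_inner_self_eq_norm_sq, norm_smul,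
    Real.norm_of_nonneg ht0]
  nlinarith [le_abs_self (y + c)]

theorem fconj_fconj_le_s12 {f : H → EReal} {y : H} {c : ℝ} (h : f y ≤ (c : EReal)) :
    fconj (fconj f) y ≤ (c : EReal) := by
  refine iSup_le fun x =>
    (EReal.sub_le_sub le_rfl (inner_sub_coe_le_fconj h x)).trans ?_
  rw [← EReal.coe_sub, EReal.coe_le_coe_iff, real_inner_comm]
  linarith

theorem affine_le_fconj_fconj {f : H → EReal} {v : H} {d : ℝ}
    (h : ∀ z, ((⟪z, v⟫ + d : ℝ) : EReal) ≤ f z) (y : H) :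
    ((⟪y, v⟫ + d : ℝ) : EReal) ≤ fconj (fconj f) y := by
  simpa [real_inner_comm] using inner_sub_coe_le_fconj (fconj_le_neg_of_affine_le h) y

theorem affine_le_menv {γ : ℝ} (hγ : 0 < γ) {f : H → EReal} {v : H} {d : ℝ}
    (h : ∀ z, ((⟪z, v⟫ + d : ℝ) : EReal) ≤ f z) (x : H) :
    ((⟪x, v⟫ + (d - γ / 2 * ‖v‖ ^ 2) : ℝ) : EReal) ≤ menv γ f x := by
  refine le_iInf fun y => le_trans ?_ (add_le_add_left (h y) _)
  rw [← EReal.coe_add, EReal.coe_le_coe_iff]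
  have hxy : ⟪x, v⟫ - ⟪y, v⟫ ≤ ‖x - y‖ * ‖v‖ := by
    rw [← inner_sub_left]
    exact real_inner_le_norm _ _
  have hsq : ‖x - y‖ ^ 2 / (2 * γ) + γ / 2 * ‖v‖ ^ 2 - ‖x - y‖ * ‖v‖
      = (‖x - y‖ - γ * ‖v‖) ^ 2 / (2 * γ) := by
    field_simp
    ring
  have : 0 ≤ (‖x - y‖ - γ * ‖v‖) ^ 2 / (2 * γ) := by positivity
  linarith

/-- The conjugate of a function that is bounded below, somewhere finite, and `⊤` outside the ball
of radius `K` is real-valued, convex and `K`-Lipschitz. -/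
theorem exists_convexOn_lipschitzWith_eq_fconj {f : H → EReal} {K m : ℝ}
    (hm : ∀ x, (m : EReal) ≤ f x) (htop : ∀ x, K < ‖x‖ → f x = ⊤) {v : H} (hv : f v ≠ ⊤) :
    ∃ F : H → ℝ, (∀ u, fconj f u = (F u : EReal)) ∧ ConvexOn ℝ Set.univ F ∧
      LipschitzWith (Real.toNNReal K) F := by
  have hcases : ∀ x, f x = ⊤ ∨ ‖x‖ ≤ K ∧ ∃ r : ℝ, m ≤ r ∧ f x = (r : EReal) := by
    intro x
    by_cases hx : f x = ⊤
    · exact Or.inl hx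
    · have hbot : f x ≠ ⊥ := fun h => by simpa [h] using hm x
      refine Or.inr ⟨not_lt.1 fun h => hx (htop x h), (f x).toReal, ?_,
        (EReal.coe_toReal hx hbot).symm⟩
      rw [← EReal.coe_le_coe_iff, EReal.coe_toReal hx hbot]
      exact hm x
  have hle : ∀ u (t : ℝ), (∀ x (r : ℝ), ‖x‖ ≤ K → m ≤ r → f x = (r : EReal) → ⟪x, u⟫ - r ≤ t) →
      fconj f u ≤ (t : EReal) := by
    refine fun u t h => iSup_le fun x => ?_
    rcases hcases x with hx | ⟨hxK, r, hr, hx⟩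
    · simp [hx]
    · rw [hx, ← EReal.coe_sub, EReal.coe_le_coe_iff]
      exact h x r hxK hr hx
  have hfin : ∀ u, ∃ r : ℝ, fconj f u = (r : EReal) := by
    intro u
    have h1 : fconj f u ≠ ⊤ := by
      refine ne_top_of_le_ne_top (EReal.coe_ne_top _) (hle u (K * ‖u‖ - m) ?_)
      intro x r hx hr _
      have := real_inner_le_norm x u
      have := mul_le_mul_of_nonneg_right hx (norm_nonneg u)
      linarith
    have h2 : fconj f u ≠ ⊥ := by
      obtain hx | ⟨-, r, -, hx⟩ := hcases v
      · exact absurd hx hv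
      · exact ne_bot_of_le_ne_bot (EReal.coe_ne_bot _) (inner_sub_coe_le_fconj hx.le u)
    exact ⟨(fconj f u).toReal, (EReal.coe_toReal h1 h2).symm⟩
  choose F hF using hfin
  have hF_ge : ∀ u x (r : ℝ), f x = (r : EReal) → ⟪x, u⟫ - r ≤ F u := by
    intro u x r hx
    rw [← EReal.coe_le_coe_iff, ← hF]
    exact inner_sub_coe_le_fconj hx.le u
  have hF_le : ∀ u (t : ℝ),
      (∀ x (r : ℝ), ‖x‖ ≤ K → m ≤ r → f x = (r : EReal) → ⟪x, u⟫ - r ≤ t) → F u ≤ t := by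
    intro u t h
    rw [← EReal.coe_le_coe_iff, ← hF]
    exact hle u t h
  refine ⟨F, hF, ⟨convex_univ, ?_⟩, LipschitzWith.of_le_add_mul' K ?_⟩
  · intro u _ w _ a b ha hb hab
    refine hF_le _ _ fun x r _ _ hx => ?_
    have hu := mul_le_mul_of_nonneg_left (hF_ge u x r hx) ha
    have hw := mul_le_mul_of_nonneg_left (hF_ge w x r hx) hb
    have hr : a * r + b * r = r := by rw [← add_mul, hab, one_mul]
    simp only [inner_add_right, real_inner_smul_right, smul_eq_mul]
    linarith
  · intro u w
    refine hF_le _ _ fun x r hxK _ hx => ?_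
    have hw := hF_ge w x r hx
    have hd : ⟪x, u⟫ - ⟪x, w⟫ ≤ K * dist u w := by
      rw [← inner_sub_right, dist_eq_norm]
      exact (real_inner_le_norm _ _).trans (mul_le_mul_of_nonneg_right hxK (norm_nonneg _))
    linarith

/-- Subtracting a multiple of the quadratic kernel before conjugating keeps the conjugate of `f*`
Lipschitz when `f` has linear growth and a continuous affine minorant. -/
theorem exists_convexOn_lipschitzWith_eq_fconj_fconj_sub_qk {f : H → EReal} {c K a : ℝ}
    (hK : 0 ≤ K) (ha : 0 ≤ a) (hf : ∀ z, f z ≤ ((c + K * ‖z‖ : ℝ) : EReal))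
    (hminor : HasAffMinorant f) :
    ∃ F : H → ℝ, (∀ u, fconj (fun x => fconj f x - ((a * qk x : ℝ) : EReal)) u = (F u : EReal)) ∧
      ConvexOn ℝ Set.univ F ∧ LipschitzWith (Real.toNNReal K) F := by
  obtain ⟨v, d, hvd⟩ := hminor
  have htop : ∀ x, K < ‖x‖ → fconj f x - ((a * qk x : ℝ) : EReal) = ⊤ := fun x hx => by
    rw [fconj_eq_top_of_lt_norm hK hf hx, EReal.top_sub_coe]
  refine exists_convexOn_lipschitzWith_eq_fconj (m := -c - a * (K ^ 2 / 2)) (fun x => ?_) htop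
    (v := v) ?_
  · rcases lt_or_ge K ‖x‖ with hx | hx
    · exact le_top.trans_eq (htop x hx).symm
    · have h0 := inner_sub_coe_le_fconj (hf 0) x
      simp only [inner_zero_left, norm_zero, mul_zero, add_zero, zero_sub] at h0
      refine le_trans ?_ (EReal.sub_le_sub h0 le_rfl)
      rw [← EReal.coe_sub, EReal.coe_le_coe_iff, qk]
      gcongr
  · refine ne_top_of_le_ne_top (EReal.coe_ne_top _)
      (EReal.sub_le_sub (fconj_le_neg_of_affine_le hvd) le_rfl)

theorem ConvexOn.hasAffMinorant [CompleteSpace H] {g : H → ℝ} (hg : ConvexOn ℝ Set.univ g)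
    (hgc : LowerSemicontinuous g) : HasAffMinorant fun y => (g y : EReal) := by
  obtain ⟨l, c, hlc, -⟩ := ConvexOn.exists_affine_le_of_lt (𝕜 := ℝ) (Set.mem_univ (0 : H))
    (sub_one_lt (g 0)) isClosed_univ (lowerSemicontinuousOn_univ_iff.2 hgc) hg
  refine ⟨(InnerProductSpace.toDual ℝ H).symm l, c, fun x => ?_⟩
  rw [EReal.coe_le_coe_iff, real_inner_comm, InnerProductSpace.toDual_symm_apply]
  simpa using hlc ⟨x, Set.mem_univ x⟩

end Conjugate

/-- If `g : G → ℝ` is convex and `β`-Lipschitzian and `0 < ‖L‖ ≤ 1`, then `L ⊚_γ g`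
is a real-valued convex function that is `(β‖L‖)`-Lipschitzian. -/
theorem proxCocomp_lipschitz
    {H G : Type*} [NormedAddCommGroup H] [InnerProductSpace ℝ H] [CompleteSpace H]
    [NormedAddCommGroup G] [InnerProductSpace ℝ G] [CompleteSpace G]
    (L : H →L[ℝ] G) (hL0 : 0 < ‖L‖) (hL1 : ‖L‖ ≤ 1)
    (β : ℝ) (hβ : 0 < β) (γ : ℝ) (hγ : 0 < γ)
    (g : G → ℝ) (hgc : ConvexOn ℝ Set.univ g) (hgl : LipschitzWith (Real.toNNReal β) g) :
    ∃ f : H → ℝ, (∀ x : H, proxCocomp L γ (fun y : G => ((g y : ℝ) : EReal)) x = ((f x : ℝ) : EReal)) ∧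
      ConvexOn ℝ Set.univ f ∧ LipschitzWith (Real.toNNReal (β * ‖L‖)) f := by
  obtain ⟨v, d, hvd⟩ := hgc.hasAffMinorant hgl.continuous.lowerSemicontinuous
  refine exists_convexOn_lipschitzWith_eq_fconj_fconj_sub_qk (c := g 0) (by positivity)
    (by positivity) (fun z => ?_) ⟨ContinuousLinearMap.adjoint L v,
      d - 1 / (1 / γ) / 2 * ‖v‖ ^ 2, fun z => ?_⟩
  · refine ((menv_le _ _).trans (fconj_fconj_le_s12 (f := fun y => (g y : EReal)) le_rfl)).trans ?_
    have hlip := hgl.dist_le_mul (L z) 0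
    rw [Real.coe_toNNReal β hβ.le, dist_zero_right, Real.dist_eq] at hlip
    have hLz := mul_le_mul_of_nonneg_left (L.le_opNorm z) hβ.le
    rw [EReal.coe_le_coe_iff, mul_assoc]
    linarith [le_abs_self (g (L z) - g 0)]
  · rw [ContinuousLinearMap.adjoint_inner_right]
    exact affine_le_menv (by positivity) (affine_le_fconj_fconj hvd) (L z)
end
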